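/- Catoni's bound with the Φ transform for the 0-1 loss: for a > 0 let Φ_a(p) = −log(1 − p(1 − e^{−a})) / a, whose inverse is Φ_a^{−1}(q) = (1 − e^{−aq}) / (1 − e^{−a}). Then for any λ > 0 and any ε ∈ (0,1), with probability at least 1 − ε over the i.i.d. sample S, simultaneously for all ρ ∈ P(Θ): E_{θ∼ρ}[R(θ)] ≤ Φ_{λ/n}^{−1}( E_{θ∼ρ}[r(θ)] + ( KL(ρ‖π) + log(1/ε) ) / λ ). -/

import Mathlib

open MeasureTheory
open scoped ENNReal

/- Kullback-Leibler divergence: `∫ log (dρ/dπ) dρ` when `ρ ≪ π` (and the integral is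
well-defined), `+∞` otherwise. -/
open Classical in
noncomputable def KL {Θ : Type*} [MeasurableSpace Θ] (ρ π : Measure Θ) : ℝ≥0∞ :=
  if ρ ≪ π ∧ Integrable (fun θ => Real.log ((ρ.rnDeriv π) θ).toReal) ρ
  then ENNReal.ofReal (∫ θ, Real.log ((ρ.rnDeriv π) θ).toReal ∂ρ)
  else ⊤

/- The 0-1 loss: `ℓ(y',y) = 1` if `y' ≠ y` and `0` otherwise. -/
open Classical in
noncomputable def loss01 {Y : Type*} (y' y : Y) : ℝ := if y' = y then 0 else 1

/- The risk `R(θ) = E_{(X,Y)∼P}[ℓ(f_θ(X),Y)]` for the 0-1 loss. -/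
noncomputable def risk01 {X Y Θ : Type*} [MeasurableSpace X] [MeasurableSpace Y]
    (P : Measure (X × Y)) (f : Θ → X → Y) (θ : Θ) : ℝ :=
  ∫ p, loss01 (f θ p.1) p.2 ∂P

/- The empirical risk `r(θ) = (1/n) ∑ᵢ ℓ(f_θ(Xᵢ),Yᵢ)` for the 0-1 loss. -/
noncomputable def empRisk01 {X Y Θ : Type*} (f : Θ → X → Y)
    (n : ℕ) (ω : Fin n → X × Y) (θ : Θ) : ℝ :=
  (∑ i, loss01 (f θ (ω i).1) (ω i).2) / n

/- The inverse of Catoni's transform `Φ_a`: `Φ_a⁻¹(q) = (1 - e^{-aq})/(1 - e^{-a})`. -/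
noncomputable def PhiInv (a q : ℝ) : ℝ := (1 - Real.exp (-(a * q))) / (1 - Real.exp (-a))

lemma loss01_eq_zero_or_one {Y : Type*} (y' y : Y) : loss01 y' y = 0 ∨ loss01 y' y = 1 := by
  unfold loss01
  split_ifs <;> simp

lemma loss01_mem_Icc {Y : Type*} (y' y : Y) : loss01 y' y ∈ Set.Icc (0 : ℝ) 1 := by
  rcases loss01_eq_zero_or_one y' y with h | h <;> simp [h]

lemma empRisk01_mem_Icc {X Y Θ : Type*} (f : Θ → X → Y) (n : ℕ)
    (ω : Fin n → X × Y) (θ : Θ) :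
    empRisk01 f n ω θ ∈ Set.Icc (0 : ℝ) 1 := by
  refine ⟨div_nonneg (Finset.sum_nonneg fun _ _ => (loss01_mem_Icc _ _).1) n.cast_nonneg,
    div_le_one_of_le₀ ?_ n.cast_nonneg⟩
  calc ∑ i, loss01 (f θ (ω i).1) (ω i).2 ≤ ∑ _ : Fin n, (1 : ℝ) :=
        Finset.sum_le_sum fun _ _ => (loss01_mem_Icc _ _).2
    _ = n := by simp

/-- The variational inequality of Donsker and Varadhan. -/
lemma integral_le_integral_llr_add_log_integral_exp {α : Type*} [MeasurableSpace α]
    {μ ν : Measure α} [IsProbabilityMeasure μ] [IsProbabilityMeasure ν] (hμν : μ ≪ ν)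
    (h_int : Integrable (llr μ ν) μ) {g : α → ℝ} (hg : Integrable g μ)
    (hexp : Integrable (fun x => Real.exp (g x)) ν) :
    ∫ x, g x ∂μ ≤ ∫ x, llr μ ν x ∂μ + Real.log (∫ x, Real.exp (g x) ∂ν) := by
  have := isProbabilityMeasure_tilted hexp
  have hnonneg := InformationTheory.integral_llr_add_sub_measure_univ_nonneg
    (hμν.trans (absolutelyContinuous_tilted hexp))
    (integrable_llr_tilted_right hμν hg h_int hexp)
  rw [integral_llr_tilted_right hμν hg hexp h_int] at hnonneg
  simp only [probReal_univ] at hnonneg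
  linarith

lemma integral_log_le_log_integral {α : Type*} [MeasurableSpace α] {μ : Measure α}
    [IsProbabilityMeasure μ] {u : α → ℝ} (hu : ∀ x, 0 < u x) (hu_int : Integrable u μ)
    (hlog : Integrable (fun x => Real.log (u x)) μ) :
    ∫ x, Real.log (u x) ∂μ ≤ Real.log (∫ x, u x ∂μ) := by
  have hm : 0 < ∫ x, u x ∂μ := by
    rw [integral_pos_iff_support_of_nonneg (fun x => (hu x).le) hu_int,
      Set.eq_univ_of_forall fun x => Function.mem_support.2 (hu x).ne']
    simp
  set m := ∫ x, u x ∂μ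
  calc ∫ x, Real.log (u x) ∂μ ≤ ∫ x, (Real.log m + (u x / m - 1)) ∂μ := by
        refine integral_mono hlog (by fun_prop) fun x => ?_
        have h := Real.log_le_sub_one_of_pos (div_pos (hu x) hm)
        rw [Real.log_div (hu x).ne' hm.ne'] at h
        dsimp only
        linarith
    _ = Real.log m := by
        rw [integral_add (by fun_prop) (by fun_prop), integral_sub (by fun_prop) (by fun_prop),
          integral_div]
        simp [m, div_self hm.ne']

/-- Markov's inequality for a nonnegative function of mean at most one. -/
lemma ofReal_one_sub_le_measure_lt {Ω : Type*} [MeasurableSpace Ω] {μ : Measure Ω}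
    [IsProbabilityMeasure μ] {Z : Ω → ℝ≥0∞} (hZ : Measurable Z) (hmean : ∫⁻ ω, Z ω ∂μ ≤ 1)
    {ε : ℝ} (hε : 0 < ε) :
    ENNReal.ofReal (1 - ε) ≤ μ {ω | Z ω < ENNReal.ofReal (1 / ε)} := by
  have hmarkov : μ {ω | ENNReal.ofReal (1 / ε) ≤ Z ω} ≤ ENNReal.ofReal ε := by
    refine (meas_ge_le_lintegral_div hZ.aemeasurable (by simpa using hε)
      ENNReal.ofReal_ne_top).trans ?_
    refine (ENNReal.div_le_div_right hmean _).trans ?_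
    rw [one_div ε, ENNReal.ofReal_inv_of_pos hε, one_div, inv_inv]
  have hcompl : {ω | Z ω < ENNReal.ofReal (1 / ε)} = {ω | ENNReal.ofReal (1 / ε) ≤ Z ω}ᶜ := by
    ext ω
    simp
  rw [hcompl, prob_compl_eq_one_sub (measurableSet_le measurable_const hZ),
    ENNReal.ofReal_sub _ hε.le, ENNReal.ofReal_one]
  exact tsub_le_tsub_left hmarkov 1

lemma one_sub_mul_mem_Icc {a p : ℝ} (ha : 0 < a) (hp : p ∈ Set.Icc (0 : ℝ) 1) :
    1 - (1 - Real.exp (-a)) * p ∈ Set.Icc (Real.exp (-a)) 1 := by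
  have h : Real.exp (-a) < 1 := Real.exp_lt_one_iff.2 (by linarith)
  constructor <;> nlinarith [hp.1, hp.2]

lemma log_one_sub_mul_mem_Icc {a p : ℝ} (ha : 0 < a) (hp : p ∈ Set.Icc (0 : ℝ) 1) :
    Real.log (1 - (1 - Real.exp (-a)) * p) ∈ Set.Icc (-a) 0 := by
  obtain ⟨h₁, h₂⟩ := one_sub_mul_mem_Icc ha hp
  exact ⟨(Real.le_log_iff_exp_le ((Real.exp_pos _).trans_le h₁)).2 h₁,
    Real.log_nonpos ((Real.exp_pos _).le.trans h₁) h₂⟩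

section Catoni

variable {X Y Θ : Type*} [MeasurableSpace X] [MeasurableSpace Y] [MeasurableSpace Θ]

lemma measurable_loss01_section {f : Θ → X → Y}
    (hmeas : Measurable (fun p : Θ × X × Y => loss01 (f p.1 p.2.1) p.2.2)) (θ : Θ) :
    Measurable (fun z : X × Y => loss01 (f θ z.1) z.2) :=
  hmeas.comp measurable_prodMk_left

lemma integrable_loss01 {P : Measure (X × Y)} [IsProbabilityMeasure P] {f : Θ → X → Y}
    (hmeas : Measurable (fun p : Θ × X × Y => loss01 (f p.1 p.2.1) p.2.2)) (θ : Θ) :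
    Integrable (fun z : X × Y => loss01 (f θ z.1) z.2) P :=
  Integrable.of_mem_Icc 0 1 (measurable_loss01_section hmeas θ).aemeasurable
    (ae_of_all _ fun _ => loss01_mem_Icc _ _)

lemma risk01_mem_Icc {P : Measure (X × Y)} [IsProbabilityMeasure P] {f : Θ → X → Y}
    (hmeas : Measurable (fun p : Θ × X × Y => loss01 (f p.1 p.2.1) p.2.2)) (θ : Θ) :
    risk01 P f θ ∈ Set.Icc (0 : ℝ) 1 := by
  refine ⟨integral_nonneg fun _ => (loss01_mem_Icc _ _).1, ?_⟩
  calc risk01 P f θ ≤ ∫ _, (1 : ℝ) ∂P :=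
        integral_mono (integrable_loss01 hmeas θ) (integrable_const _)
          fun _ => (loss01_mem_Icc _ _).2
    _ = 1 := by simp

lemma measurable_risk01 {P : Measure (X × Y)} [IsProbabilityMeasure P] {f : Θ → X → Y}
    (hmeas : Measurable (fun p : Θ × X × Y => loss01 (f p.1 p.2.1) p.2.2)) :
    Measurable (risk01 P f) :=
  (hmeas.stronglyMeasurable.integral_prod_right' (ν := P)).measurable

lemma measurable_empRisk01 {f : Θ → X → Y}
    (hmeas : Measurable (fun p : Θ × X × Y => loss01 (f p.1 p.2.1) p.2.2)) (n : ℕ) :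
    Measurable (fun p : (Fin n → X × Y) × Θ => empRisk01 f n p.1 p.2) := by
  unfold empRisk01
  refine (Finset.measurable_sum _ fun i _ => ?_).div_const _
  exact hmeas.comp (measurable_snd.prodMk ((measurable_pi_apply i).comp measurable_fst))

/-- Up to the factor `λ = n a`, the deviation `Φ_a(R(θ)) - r(θ)`. -/
noncomputable def catoniExponent (P : Measure (X × Y)) (f : Θ → X → Y) (n : ℕ) (a : ℝ)
    (ω : Fin n → X × Y) (θ : Θ) : ℝ :=
  -(n * Real.log (1 - (1 - Real.exp (-a)) * risk01 P f θ)) - n * a * empRisk01 f n ω θ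

variable {P : Measure (X × Y)} [IsProbabilityMeasure P] {f : Θ → X → Y}

lemma measurable_catoniExponent
    (hmeas : Measurable (fun p : Θ × X × Y => loss01 (f p.1 p.2.1) p.2.2)) (n : ℕ) (a : ℝ) :
    Measurable (fun p : (Fin n → X × Y) × Θ => catoniExponent P f n a p.1 p.2) := by
  unfold catoniExponent
  have h₁ := (measurable_risk01 (P := P) hmeas).comp
    (measurable_snd : Measurable (Prod.snd : (Fin n → X × Y) × Θ → Θ))
  have h₂ := measurable_empRisk01 hmeas n
  simp only [Function.comp_def] at h₁
  fun_prop

lemma catoniExponent_le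
    (hmeas : Measurable (fun p : Θ × X × Y => loss01 (f p.1 p.2.1) p.2.2)) (n : ℕ) {a : ℝ}
    (ha : 0 < a) (ω : Fin n → X × Y) (θ : Θ) : catoniExponent P f n a ω θ ≤ n * a := by
  have h₁ := (log_one_sub_mul_mem_Icc ha (risk01_mem_Icc (P := P) hmeas θ)).1
  have h₂ : 0 ≤ n * a * empRisk01 f n ω θ :=
    mul_nonneg (by positivity) (empRisk01_mem_Icc f n ω θ).1
  have h₃ := mul_le_mul_of_nonneg_left h₁ n.cast_nonneg
  unfold catoniExponent
  linarith

lemma exp_catoniExponent_eq_prod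
    (hmeas : Measurable (fun p : Θ × X × Y => loss01 (f p.1 p.2.1) p.2.2)) {n : ℕ} (hn : 0 < n)
    {a : ℝ} (ha : 0 < a) (ω : Fin n → X × Y) (θ : Θ) :
    Real.exp (catoniExponent P f n a ω θ) =
      ∏ i, (1 - (1 - Real.exp (-a)) * loss01 (f θ (ω i).1) (ω i).2) /
        (1 - (1 - Real.exp (-a)) * risk01 P f θ) := by
  have hpos : 0 < 1 - (1 - Real.exp (-a)) * risk01 P f θ :=
    (Real.exp_pos _).trans_le (one_sub_mul_mem_Icc ha (risk01_mem_Icc hmeas θ)).1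
  have hfactor : ∀ y' y : Y,
      1 - (1 - Real.exp (-a)) * loss01 y' y = Real.exp (-(a * loss01 y' y)) := fun y' y => by
    rcases loss01_eq_zero_or_one y' y with h | h <;> simp [h]
  have hn' : (n : ℝ) ≠ 0 := by positivity
  rw [Finset.prod_div_distrib, Finset.prod_const, Finset.card_univ, Fintype.card_fin]
  simp_rw [hfactor]
  rw [← Real.exp_sum, catoniExponent, sub_eq_add_neg, Real.exp_add, Real.exp_neg, Real.exp_nat_mul,
    Real.exp_log hpos, mul_comm, div_eq_mul_inv]
  congr 2
  rw [Finset.sum_neg_distrib, ← Finset.mul_sum, empRisk01]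
  field_simp

lemma lintegral_exp_catoniExponent
    (hmeas : Measurable (fun p : Θ × X × Y => loss01 (f p.1 p.2.1) p.2.2)) {n : ℕ} (hn : 0 < n)
    {a : ℝ} (ha : 0 < a) (θ : Θ) :
    ∫⁻ ω, ENNReal.ofReal (Real.exp (catoniExponent P f n a ω θ)) ∂(Measure.pi fun _ => P) = 1 := by
  have hpos : 0 < 1 - (1 - Real.exp (-a)) * risk01 P f θ :=
    (Real.exp_pos _).trans_le (one_sub_mul_mem_Icc ha (risk01_mem_Icc hmeas θ)).1
  have hsection : Measurable fun ω => catoniExponent P f n a ω θ :=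
    (measurable_catoniExponent hmeas n a).comp measurable_prodMk_right
  have hint : Integrable (fun ω => Real.exp (catoniExponent P f n a ω θ))
      (Measure.pi fun _ => P) :=
    Integrable.of_mem_Icc 0 (Real.exp (n * a)) hsection.exp.aemeasurable
      (ae_of_all _ fun ω =>
        ⟨(Real.exp_pos _).le, Real.exp_le_exp.2 (catoniExponent_le hmeas n ha ω θ)⟩)
  rw [← ofReal_integral_eq_lintegral_ofReal hint (ae_of_all _ fun _ => (Real.exp_pos _).le)]
  simp_rw [exp_catoniExponent_eq_prod hmeas hn ha]
  rw [integral_fintype_prod_eq_pow (fun z : X × Y =>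
    (1 - (1 - Real.exp (-a)) * loss01 (f θ z.1) z.2) /
        (1 - (1 - Real.exp (-a)) * risk01 P f θ))]
  rw [integral_div, integral_sub (integrable_const _) ((integrable_loss01 hmeas θ).const_mul _),
    integral_const_mul]
  change ENNReal.ofReal (((∫ _, (1 : ℝ) ∂P - (1 - Real.exp (-a)) * risk01 P f θ) / _) ^ _) = 1
  simp [div_self hpos.ne']

lemma lintegral_lintegral_exp_catoniExponent
    (hmeas : Measurable (fun p : Θ × X × Y => loss01 (f p.1 p.2.1) p.2.2)) (π : Measure Θ)
    [IsProbabilityMeasure π] {n : ℕ} (hn : 0 < n) {a : ℝ} (ha : 0 < a) :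
    ∫⁻ ω, ∫⁻ θ, ENNReal.ofReal (Real.exp (catoniExponent P f n a ω θ)) ∂π
      ∂(Measure.pi fun _ => P) = 1 := by
  rw [lintegral_lintegral_swap
    (measurable_catoniExponent hmeas n a).exp.ennreal_ofReal.aemeasurable]
  simp [lintegral_exp_catoniExponent hmeas hn ha]

/-- Jensen's inequality for `Φ_a`, integrated against a posterior. -/
lemma neg_log_one_sub_integral_risk01_le
    (hmeas : Measurable (fun p : Θ × X × Y => loss01 (f p.1 p.2.1) p.2.2)) {n : ℕ}
    {a : ℝ} (ha : 0 < a) (ω : Fin n → X × Y) (ρ : Measure Θ) [IsProbabilityMeasure ρ] :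
    Integrable (catoniExponent P f n a ω) ρ ∧
      -(n * Real.log (1 - (1 - Real.exp (-a)) * ∫ θ, risk01 P f θ ∂ρ))
        - n * a * ∫ θ, empRisk01 f n ω θ ∂ρ ≤ ∫ θ, catoniExponent P f n a ω θ ∂ρ := by
  have hR := measurable_risk01 (P := P) hmeas
  have hr : Measurable (empRisk01 f n ω) :=
    (measurable_empRisk01 hmeas n).comp measurable_prodMk_left
  have hR_int : Integrable (risk01 P f) ρ :=
    Integrable.of_mem_Icc 0 1 hR.aemeasurable (ae_of_all _ fun θ => risk01_mem_Icc hmeas θ)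
  have hr_int : Integrable (empRisk01 f n ω) ρ :=
    Integrable.of_mem_Icc 0 1 hr.aemeasurable (ae_of_all _ fun θ => empRisk01_mem_Icc f n ω θ)
  have hlog_int : Integrable
      (fun θ => Real.log (1 - (1 - Real.exp (-a)) * risk01 P f θ)) ρ :=
    Integrable.of_mem_Icc (-a) 0 (by fun_prop)
      (ae_of_all _ fun θ => log_one_sub_mul_mem_Icc ha (risk01_mem_Icc hmeas θ))
  have hjensen := integral_log_le_log_integral
    (fun θ => (Real.exp_pos _).trans_le
      (one_sub_mul_mem_Icc ha (risk01_mem_Icc (P := P) hmeas θ)).1)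
    ((integrable_const _).sub (hR_int.const_mul _)) hlog_int
  rw [integral_sub (integrable_const _) (hR_int.const_mul _), integral_const_mul] at hjensen
  simp only [integral_const, probReal_univ, smul_eq_mul, mul_one] at hjensen
  have hint₁ : Integrable
      (fun θ => -(n * Real.log (1 - (1 - Real.exp (-a)) * risk01 P f θ))) ρ :=
    (hlog_int.const_mul (n : ℝ)).neg
  have hint₂ := hr_int.const_mul (n * a)
  refine ⟨hint₁.sub hint₂, ?_⟩
  unfold catoniExponent
  rw [integral_sub hint₁ hint₂, integral_neg, integral_const_mul, integral_const_mul]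
  have := mul_le_mul_of_nonneg_left hjensen n.cast_nonneg
  linarith

end Catoni

lemma le_PhiInv_of_neg_log_le {a p q : ℝ} (ha : 0 < a) (hp : p ∈ Set.Icc (0 : ℝ) 1)
    (h : -Real.log (1 - (1 - Real.exp (-a)) * p) ≤ a * q) : p ≤ PhiInv a q := by
  have hc : 0 < 1 - Real.exp (-a) := sub_pos.2 (Real.exp_lt_one_iff.2 (by linarith))
  have hpos := (Real.exp_pos _).trans_le (one_sub_mul_mem_Icc ha hp).1
  have hexp := (Real.le_log_iff_exp_le hpos).1 (neg_le.1 h)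
  rw [PhiInv, le_div_iff₀ hc]
  linarith

/-- Catoni's bound with the `Φ` transform for the 0-1 loss: with probability at least
`1 - ε`, simultaneously for all `ρ ∈ P(Θ)` (with `KL(ρ‖π) < ∞`; otherwise the bound is
vacuous), `E_{θ∼ρ}[R(θ)] ≤ Φ_{λ/n}⁻¹( E_{θ∼ρ}[r(θ)] + (KL(ρ‖π) + log(1/ε))/λ )`. -/
theorem catoni_phi_pac_bayes_bound
    {X Y Θ : Type*} [MeasurableSpace X] [MeasurableSpace Y] [MeasurableSpace Θ]
    (P : Measure (X × Y)) [IsProbabilityMeasure P]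
    (f : Θ → X → Y)
    (hmeas : Measurable (fun p : Θ × X × Y => loss01 (f p.1 p.2.1) p.2.2))
    (π : Measure Θ) [IsProbabilityMeasure π]
    (n : ℕ) (hn : 0 < n) (lam ε : ℝ) (hlam : 0 < lam) (hε : ε ∈ Set.Ioo (0:ℝ) 1) :
    ENNReal.ofReal (1 - ε) ≤
      (Measure.pi fun _ : Fin n => P)
        {ω | ∀ ρ : Measure Θ, IsProbabilityMeasure ρ → KL ρ π ≠ ⊤ →
          ∫ θ, risk01 P f θ ∂ρ ≤
            PhiInv (lam / n)
              ((∫ θ, empRisk01 f n ω θ ∂ρ)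
                + ((KL ρ π).toReal + Real.log (1 / ε)) / lam)} := by
  have hn' : (0 : ℝ) < n := by exact_mod_cast hn
  have ha : 0 < lam / n := by positivity
  have hna : (n : ℝ) * (lam / n) = lam := by field_simp
  have hexp_meas := (measurable_catoniExponent (P := P) hmeas n (lam / n)).exp
  refine (ofReal_one_sub_le_measure_lt hexp_meas.ennreal_ofReal.lintegral_prod_right'
    (lintegral_lintegral_exp_catoniExponent hmeas π hn ha).le hε.1).trans
    (measure_mono fun ω hω ρ _ hKL => ?_)
  obtain ⟨hac, hllr⟩ : ρ ≪ π ∧ Integrable (llr ρ π) ρ := by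
    by_contra hcon
    exact hKL (if_neg hcon)
  have hKL_le : ∫ θ, llr ρ π θ ∂ρ ≤ (KL ρ π).toReal := by
    rw [KL, if_pos ⟨hac, hllr⟩, ENNReal.toReal_ofReal']
    exact le_max_left _ _
  obtain ⟨hint, hjensen⟩ := neg_log_one_sub_integral_risk01_le (P := P) hmeas ha ω ρ
  have hexp_int : Integrable (fun θ => Real.exp (catoniExponent P f n (lam / n) ω θ)) π :=
    Integrable.of_mem_Icc 0 (Real.exp (n * (lam / n)))
      (hexp_meas.comp measurable_prodMk_left).aemeasurable
      (ae_of_all _ fun θ =>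
        ⟨(Real.exp_pos _).le, Real.exp_le_exp.2 (catoniExponent_le hmeas n ha ω θ)⟩)
  have hZ : ∫ θ, Real.exp (catoniExponent P f n (lam / n) ω θ) ∂π < 1 / ε := by
    rw [Set.mem_ofPred_eq, ← ofReal_integral_eq_lintegral_ofReal hexp_int
      (ae_of_all _ fun _ => (Real.exp_pos _).le)] at hω
    exact (ENNReal.ofReal_lt_ofReal_iff (one_div_pos.2 hε.1)).1 hω
  have hlogZ := Real.log_le_log (integral_exp_pos hexp_int) hZ.le
  have hDV := integral_le_integral_llr_add_log_integral_exp hac hllr hint hexp_int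
  have hR : ∫ θ, risk01 P f θ ∂ρ ∈ Set.Icc (0 : ℝ) 1 := by
    refine ⟨integral_nonneg fun θ => (risk01_mem_Icc hmeas θ).1, ?_⟩
    refine (integral_mono_of_nonneg (ae_of_all _ fun θ => (risk01_mem_Icc hmeas θ).1)
      (integrable_const 1) (ae_of_all _ fun θ => (risk01_mem_Icc hmeas θ).2)).trans_eq (by simp)
  refine le_PhiInv_of_neg_log_le ha hR (le_of_mul_le_mul_left ?_ hn')
  rw [← mul_assoc, hna, mul_add, mul_div_cancel₀ _ hlam.ne']
  rw [hna] at hjensen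
  linarith
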